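/- Let (G,+) be a finite Abelian group with |G| = q whose only characteristic subgroups are {0} and G. Then every automorphic-symmetric channel W : G → 𝒴 satisfying the background polarization property strongly polarizes: for every δ > 0, lim_{n→∞} 2^{−n}·|{s ∈ {−,+}ⁿ : W^s is δ-determined by {0} or W^s is δ-determined by G}| = 1. -/

import Mathlib

open scoped Classical

noncomputable section

universe u v

/-- A (discrete memoryless) channel with input alphabet `X` and finite output alphabet `Y`:
nonnegative entries and each row sums to `1`. -/
def IsChannel {X : Type*} {Y : Type*} [Fintype Y] (W : X → Y → ℝ) : Prop :=
  (∀ x y, 0 ≤ W x y) ∧ ∀ x, ∑ y, W x y = 1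

/-- The symmetric capacity of a channel: the mutual information between a uniformly
distributed input and the corresponding output (terms with `W x y = 0` vanish). -/
def capacity {X : Type*} {Y : Type*} [Fintype X] [Fintype Y] (W : X → Y → ℝ) : ℝ :=
  ∑ y : Y, ∑ x : X, (1 / (Fintype.card X : ℝ)) * W x y *
    Real.log (W x y / ((1 / (Fintype.card X : ℝ)) * ∑ x' : X, W x' y))

/-- The quotient channel `W[H] : G ⧸ H → Y`, `W[H](y|A) = (1/|H|) ∑_{x ∈ A} W(y|x)`. -/
def quotientChannel {G : Type*} [AddCommGroup G] [Fintype G] (H : AddSubgroup G)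
    {Y : Type*} (W : G → Y → ℝ) : G ⧸ H → Y → ℝ :=
  fun A y => (1 / (Nat.card H : ℝ)) * ∑ x : G, if (x : G ⧸ H) = A then W x y else 0

/-- `W` is `δ`-determined by the subgroup `H`:
`|I(W) − log|G/H|| < δ` and `|I(W[H]) − log|G/H|| < δ`. -/
def DeterminedBy {G : Type*} [AddCommGroup G] [Fintype G] {Y : Type*} [Fintype Y]
    (W : G → Y → ℝ) (H : AddSubgroup G) (δ : ℝ) : Prop :=
  |capacity W - Real.log (Nat.card (G ⧸ H))| < δ ∧
  |capacity (quotientChannel H W) - Real.log (Nat.card (G ⧸ H))| < δ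

/-- The "minus" Arıkan transform `W⁻(y₁,y₂|u₁) = (1/q) ∑_{u₂} W(y₁|u₁+u₂) W(y₂|u₂)`. -/
def minusChannel {G : Type*} [AddCommGroup G] [Fintype G] {Y : Type*}
    (W : G → Y → ℝ) : G → Y × Y → ℝ :=
  fun u₁ y => (1 / (Fintype.card G : ℝ)) * ∑ u₂ : G, W (u₁ + u₂) y.1 * W u₂ y.2

/-- The "plus" Arıkan transform `W⁺(y₁,y₂,u₁|u₂) = (1/q) W(y₁|u₁+u₂) W(y₂|u₂)`;
the output `(y₁, y₂, u₁)` is encoded as `((y₁, y₂), u₁)`. -/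
def plusChannel {G : Type*} [AddCommGroup G] [Fintype G] {Y : Type*}
    (W : G → Y → ℝ) : G → (Y × Y) × G → ℝ :=
  fun u₂ z => (1 / (Fintype.card G : ℝ)) * W (z.2 + u₂) z.1.1 * W u₂ z.1.2

/-- `W` is degraded from `W'`: `W` is obtained from `W'` by composing with a channel `V`. -/
def DegradedFrom {X : Type*} {Y Y' : Type*} [Fintype Y] [Fintype Y'] (W : X → Y → ℝ)
    (W' : X → Y' → ℝ) : Prop :=
  ∃ V : Y' → Y → ℝ, IsChannel V ∧ ∀ x y, W x y = ∑ y' : Y', W' x y' * V y' y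

/-- Channel equivalence: mutual degradation. -/
def EquivalentChannels {X : Type*} {Y Y' : Type*} [Fintype Y] [Fintype Y'] (W : X → Y → ℝ)
    (W' : X → Y' → ℝ) : Prop :=
  DegradedFrom W W' ∧ DegradedFrom W' W

/-- The erasure channel of input alphabet `A` and parameter `ε`; the output alphabet is
`A ∪ {e}`, modelled as `Option A` with `none` as the erasure symbol `e`. For `A = G` this is
the `q`-ary erasure channel `qEC(ε)`. -/
def erasureChannel (A : Type*) (ε : ℝ) : A → Option A → ℝ :=
  fun x y => match y with
    | some z => if z = x then 1 - ε else 0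
    | none => ε

/-- `W : G → Y → ℝ` is a generalized `q`-symmetric channel. -/
def IsGeneralizedSymmetric {G : Type u} [Fintype G] {Y : Type v} [Fintype Y]
    (W : G → Y → ℝ) : Prop :=
  ∃ (Z : Type v) (_ : Fintype Z) (π : G × Z ≃ Y) (p : Z → ℝ) (ε : Z → ℝ),
    (∀ z, 0 ≤ p z) ∧ (∑ z, p z = 1) ∧
    (∀ z, 0 ≤ ε z) ∧ (∀ z, ε z ≤ 1 / ((Fintype.card G : ℝ) - 1)) ∧
    ∀ x x' z, W x (π (x', z)) =
      if x' = x then p z * (1 - ((Fintype.card G : ℝ) - 1) * ε z) else p z * ε z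

/-- `W` is automorphic-symmetric with respect to `(G,+)`: for every automorphism `f` of `G`
there is a bijection `π_f` of the output alphabet with `W(π_f(y)|f(x)) = W(y|x)`. -/
def IsAutSymmetric {G : Type*} [AddCommGroup G] {Y : Type*} (W : G → Y → ℝ) : Prop :=
  ∀ f : G ≃+ G, ∃ π : Y ≃ Y, ∀ x y, W (f x) (π y) = W x y

/-- A channel with input alphabet `G`, packaged with its (finite) output alphabet. -/
structure Channel (G : Type u) where
  Out : Type u
  [fin : Fintype Out]
  prob : G → Out → ℝ

attribute [instance] Channel.fin

def Channel.minus {G : Type u} [AddCommGroup G] [Fintype G] (C : Channel G) : Channel G :=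
  ⟨C.Out × C.Out, minusChannel C.prob⟩

def Channel.plus {G : Type u} [AddCommGroup G] [Fintype G] (C : Channel G) : Channel G :=
  ⟨(C.Out × C.Out) × G, plusChannel C.prob⟩

/-- `C.polar s` is the synthetic channel `W^s`, where `false` encodes `-`, `true` encodes `+`,
and the head of the list is the first transform applied. -/
def Channel.polar {G : Type u} [AddCommGroup G] [Fintype G] (C : Channel G) :
    List Bool → Channel G
  | [] => C
  | b :: s => (cond b C.plus C.minus).polar s

/-- `C` `𝓗`-polarizes: for every `δ > 0`, the fraction of `s ∈ {−,+}ⁿ` such that `W^s` is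
`δ`-determined by some subgroup in `𝓗` tends to `1` as `n → ∞`. Taking `𝓗` to be the set of
all subgroups gives the background (multilevel) polarization property. -/
def Polarizes {G : Type u} [AddCommGroup G] [Fintype G] (C : Channel G)
    (𝓗 : Set (AddSubgroup G)) : Prop :=
  ∀ δ > (0 : ℝ), Filter.Tendsto
    (fun n : ℕ => ((Finset.univ.filter (fun s : Fin n → Bool =>
        ∃ H ∈ 𝓗, DeterminedBy (C.polar (List.ofFn s)).prob H δ)).card : ℝ) / 2 ^ n)
    Filter.atTop (nhds 1)

lemma sum_fibers_mul {X A : Type*} [Fintype X] [Fintype A] [DecidableEq A] (w : X → ℝ)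
    (a : X → A) (g : A → ℝ) :
    ∑ α, (∑ x, if a x = α then w x else 0) * g α = ∑ x, w x * g (a x) := by
  simp_rw [Finset.sum_mul, ite_mul, zero_mul]
  rw [Finset.sum_comm]
  simp

/-- Unnormalized form of `H(X) ≤ H(a(X)) + H(b(X)) + log K`, where every joint fibre of `(a, b)`
has at most `K` elements. -/
lemma sum_mul_log_fibers_le {X A B : Type*} [Fintype X] [Fintype A] [Fintype B]
    [DecidableEq A] [DecidableEq B] (w : X → ℝ) (hw : ∀ x, 0 ≤ w x) (a : X → A) (b : X → B) (K : ℕ)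
    (hK : ∀ α β, (Finset.univ.filter fun x => a x = α ∧ b x = β).card ≤ K) :
    (∑ α, (∑ x, if a x = α then w x else 0) * Real.log (∑ x, if a x = α then w x else 0)) +
      (∑ β, (∑ x, if b x = β then w x else 0) * Real.log (∑ x, if b x = β then w x else 0)) -
      (∑ x, w x) * Real.log (∑ x, w x) ≤
    (∑ x, w x * Real.log (w x)) + (∑ x, w x) * Real.log K := by
  set p : A → ℝ := fun α => ∑ x, if a x = α then w x else 0 with hp
  set r : B → ℝ := fun β => ∑ x, if b x = β then w x else 0 with hr
  set S := ∑ x, w x with hS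
  have hp0 : ∀ α, 0 ≤ p α := fun α =>
    Finset.sum_nonneg fun x _ => by split_ifs <;> simp [hw]
  have hr0 : ∀ β, 0 ≤ r β := fun β =>
    Finset.sum_nonneg fun x _ => by split_ifs <;> simp [hw]
  have hS0 : 0 ≤ S := Finset.sum_nonneg fun x _ => hw x
  have hpS : ∑ α, p α = S := by simpa using sum_fibers_mul w a fun _ => 1
  have hrS : ∑ β, r β = S := by simpa using sum_fibers_mul w b fun _ => 1
  have hwp : ∀ x, w x ≤ p (a x) := fun x => by
    have := Finset.single_le_sum (f := fun x' => if a x' = a x then w x' else 0)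
      (fun x' _ => by split_ifs <;> simp [hw]) (Finset.mem_univ x)
    simpa [hp] using this
  have hwr : ∀ x, w x ≤ r (b x) := fun x => by
    have := Finset.single_le_sum (f := fun x' => if b x' = b x then w x' else 0)
      (fun x' _ => by split_ifs <;> simp [hw]) (Finset.mem_univ x)
    simpa [hr] using this
  have hwS : ∀ x, w x ≤ S := fun x =>
    Finset.single_le_sum (fun x' _ => hw x') (Finset.mem_univ x)
  have pointwise : ∀ x, w x * Real.log (p (a x)) + w x * Real.log (r (b x)) - w x * Real.log S
      - w x * Real.log (w x) - w x * Real.log K ≤ p (a x) * r (b x) / (S * K) - w x := by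
    intro x
    rcases (hw x).eq_or_lt with h | h
    · rw [← h]
      have := hp0 (a x)
      have := hr0 (b x)
      simp only [zero_mul, add_zero, sub_zero]
      positivity
    · have h1 := h.trans_le (hwp x)
      have h2 := h.trans_le (hwr x)
      have h3 := h.trans_le (hwS x)
      have h4 : (0 : ℝ) < K := by
        have : 0 < (Finset.univ.filter fun x' => a x' = a x ∧ b x' = b x).card :=
          Finset.card_pos.2 ⟨x, by simp⟩
        exact_mod_cast this.trans_le (hK _ _)
      have key := Real.log_le_sub_one_of_pos
        (show 0 < p (a x) * r (b x) / (S * w x * K) by positivity)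
      rw [Real.log_div (by positivity) (by positivity), Real.log_mul h1.ne' h2.ne',
        Real.log_mul (by positivity) h4.ne', Real.log_mul h3.ne' h.ne'] at key
      have key' := mul_le_mul_of_nonneg_left key h.le
      have e : w x * (p (a x) * r (b x) / (S * w x * K) - 1)
          = p (a x) * r (b x) / (S * K) - w x := by
        field_simp
      rw [e] at key'
      linarith
  have total : ∑ x, p (a x) * r (b x) ≤ K * (S * S) := by
    rw [← Finset.sum_fiberwise' Finset.univ (fun x => (a x, b x))
      (fun c : A × B => p c.1 * r c.2)]
    calc _ ≤ ∑ c : A × B, (K : ℝ) * (p c.1 * r c.2) := by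
          refine Finset.sum_le_sum fun c _ => ?_
          rw [Finset.sum_const, nsmul_eq_mul]
          refine mul_le_mul_of_nonneg_right ?_ (mul_nonneg (hp0 _) (hr0 _))
          have := hK c.1 c.2
          simp only [Prod.ext_iff]
          exact_mod_cast this
      _ = K * (S * S) := by
          rw [← Finset.mul_sum, Fintype.sum_prod_type, ← Finset.sum_mul_sum, hpS, hrS]
  have total' : ∑ x, p (a x) * r (b x) / (S * K) ≤ S := by
    rw [← Finset.sum_div]
    refine div_le_of_le_mul₀ (by positivity) hS0 ?_
    linarith
  have summed := Finset.sum_le_sum fun x (_ : x ∈ Finset.univ) => pointwise x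
  simp only [Finset.sum_sub_distrib, Finset.sum_add_distrib, ← Finset.sum_mul] at summed
  rw [sum_fibers_mul w a fun α => Real.log (p α), sum_fibers_mul w b fun β => Real.log (r β)]
  linarith

lemma IsChannel.sum_sum {X Y : Type*} [Fintype X] [Fintype Y] {W : X → Y → ℝ}
    (hW : IsChannel W) : ∑ y, ∑ x, W x y = Fintype.card X := by
  rw [Finset.sum_comm]
  simp [hW.2]

lemma capacity_eq {X Y : Type*} [Fintype X] [Nonempty X] [Fintype Y] {W : X → Y → ℝ}
    (hW : IsChannel W) :
    capacity W = Real.log (Fintype.card X) + (1 / (Fintype.card X : ℝ)) *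
      ∑ y, ((∑ x, W x y * Real.log (W x y)) -
        (∑ x, W x y) * Real.log (∑ x, W x y)) := by
  have hq : (0 : ℝ) < Fintype.card X := by exact_mod_cast Fintype.card_pos
  have hlog : Real.log (Fintype.card X) = (1 / (Fintype.card X : ℝ)) *
      ∑ y, (∑ x, W x y) * Real.log (Fintype.card X) := by
    rw [← Finset.sum_mul, hW.sum_sum]
    field_simp
  rw [hlog, ← mul_add, ← Finset.sum_add_distrib, capacity, Finset.mul_sum]
  refine Finset.sum_congr rfl fun y _ => ?_
  simp only [Finset.sum_mul, ← Finset.sum_add_distrib, ← Finset.sum_sub_distrib, Finset.mul_sum]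
  refine Finset.sum_congr rfl fun x _ => ?_
  rcases (hW.1 x y).eq_or_lt with h | h
  · simp [← h]
  · have hS : 0 < ∑ x', W x' y :=
      h.trans_le (Finset.single_le_sum (fun x' _ => hW.1 x' y) (Finset.mem_univ x))
    rw [← Finset.mul_sum, Real.log_div h.ne' (by positivity), Real.log_mul (by positivity) hS.ne',
      one_div, Real.log_inv]
    ring

lemma capacity_congr {X X' Y Y' : Type*} [Fintype X] [Fintype X'] [Fintype Y] [Fintype Y']
    {W : X → Y → ℝ} {W' : X' → Y' → ℝ} (e : X ≃ X') (π : Y ≃ Y')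
    (h : ∀ x y, W' (e x) (π y) = W x y) : capacity W' = capacity W := by
  unfold capacity
  rw [← Fintype.card_congr e, ← π.sum_comp]
  refine Finset.sum_congr rfl fun y _ => ?_
  rw [← e.sum_comp (fun x => W' x (π y)), ← e.sum_comp]
  simp only [h]

section Subgroups

variable {G : Type*} [AddCommGroup G] [Fintype G] {Y : Type*} [Fintype Y] {W : G → Y → ℝ}

lemma card_eq_card_quotient_mul (H : AddSubgroup G) :
    (Fintype.card G : ℝ) = Fintype.card (G ⧸ H) * Nat.card H := by
  rw [← Nat.card_eq_fintype_card, ← Nat.card_eq_fintype_card]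
  exact_mod_cast AddSubgroup.card_eq_card_quotient_mul_card_addSubgroup H

lemma log_card_quotient (H : AddSubgroup G) :
    Real.log (Nat.card (G ⧸ H)) = Real.log (Fintype.card G) - Real.log (Nat.card H) := by
  have h1 : (Nat.card (G ⧸ H) : ℝ) ≠ 0 := by exact_mod_cast Nat.card_pos.ne'
  have h2 : (Nat.card H : ℝ) ≠ 0 := by exact_mod_cast Nat.card_pos.ne'
  rw [card_eq_card_quotient_mul H, ← Nat.card_eq_fintype_card, Real.log_mul h1 h2]
  ring

lemma sum_fibers_quotient (H : AddSubgroup G) (w : G → ℝ) :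
    ∑ A : G ⧸ H, (∑ x : G, if (x : G ⧸ H) = A then w x else 0) = ∑ x, w x := by
  rw [Finset.sum_comm]
  simp

lemma isChannel_quotientChannel (hW : IsChannel W) (H : AddSubgroup G) :
    IsChannel (quotientChannel H W) := by
  constructor
  · intro A y
    refine mul_nonneg (by positivity) (Finset.sum_nonneg fun x _ => ?_)
    split_ifs
    exacts [hW.1 x y, le_rfl]
  · intro A
    obtain ⟨x₀, rfl⟩ := QuotientAddGroup.mk_surjective A
    have hcard : (Finset.univ.filter fun x : G => (x : G ⧸ H) = x₀).card = Nat.card H := by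
      rw [← Fintype.card_subtype, ← Nat.card_eq_fintype_card]
      refine Nat.card_congr (((Equiv.addLeft x₀).subtypeEquiv fun h => ?_).symm)
      simp
    have hH : (Nat.card H : ℝ) ≠ 0 := by exact_mod_cast Nat.card_pos.ne'
    simp only [quotientChannel]
    rw [← Finset.mul_sum, Finset.sum_comm]
    have : ∀ x : G, (∑ y, if (x : G ⧸ H) = x₀ then W x y else 0) =
        if (x : G ⧸ H) = x₀ then 1 else 0 := by
      intro x
      split_ifs
      · exact hW.2 x
      · simp
    rw [Finset.sum_congr rfl fun x _ => this x, Finset.sum_boole, hcard]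
    field_simp

lemma capacity_quotientChannel (hW : IsChannel W) (H : AddSubgroup G) :
    capacity (quotientChannel H W) = Real.log (Nat.card (G ⧸ H)) + (1 / (Fintype.card G : ℝ)) *
      ∑ y, ((∑ A : G ⧸ H, (∑ x : G, if (x : G ⧸ H) = A then W x y else 0) *
          Real.log (∑ x : G, if (x : G ⧸ H) = A then W x y else 0)) -
        (∑ x, W x y) * Real.log (∑ x, W x y)) := by
  have hH : (0 : ℝ) < Nat.card H := by exact_mod_cast Nat.card_pos
  have hscale : ∀ t : ℝ, 1 / (Nat.card H : ℝ) * t * Real.log (1 / (Nat.card H : ℝ) * t) =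
      1 / (Nat.card H : ℝ) * (t * Real.log t - t * Real.log (Nat.card H)) := by
    intro t
    rcases eq_or_ne t 0 with rfl | ht
    · simp
    · rw [Real.log_mul (by positivity) ht, one_div, Real.log_inv]
      ring
  rw [capacity_eq (isChannel_quotientChannel hW H), Nat.card_eq_fintype_card]
  congr 1
  simp only [quotientChannel, ← Finset.mul_sum, sum_fibers_quotient, hscale]
  rw [card_eq_card_quotient_mul H, Finset.mul_sum, Finset.mul_sum]
  refine Finset.sum_congr rfl fun y _ => ?_
  rw [Finset.sum_sub_distrib, ← Finset.sum_mul, sum_fibers_quotient]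
  field_simp
  ring

lemma card_inter_cosets_le (H H' : AddSubgroup G) (A : G ⧸ H) (B : G ⧸ H') :
    (Finset.univ.filter fun x : G => (x : G ⧸ H) = A ∧ (x : G ⧸ H') = B).card ≤
      Nat.card (H ⊓ H' : AddSubgroup G) := by
  rcases (Finset.univ.filter fun x : G => (x : G ⧸ H) = A ∧ (x : G ⧸ H') = B).eq_empty_or_nonempty
    with h | ⟨x₀, h⟩
  · simp [h]
  · simp only [Finset.mem_filter, Finset.mem_univ, true_and] at h
    rw [← Fintype.card_subtype, ← Nat.card_eq_fintype_card]
    refine Nat.card_le_card_of_injective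
      (fun x => (⟨-x₀ + x.1, ?_, ?_⟩ : (H ⊓ H' : AddSubgroup G))) ?_
    · exact QuotientAddGroup.eq.1 (h.1.trans x.2.1.symm)
    · exact QuotientAddGroup.eq.1 (h.2.trans x.2.2.symm)
    · intro x x' hx
      exact Subtype.ext (add_left_cancel (congrArg Subtype.val hx))

/-- `H(X|Y) ≤ H(X mod H|Y) + H(X mod H'|Y) + log |H ∩ H'|`. -/
lemma capacity_ge_of_quotients (hW : IsChannel W) (H H' : AddSubgroup G) :
    (capacity (quotientChannel H W) - Real.log (Nat.card (G ⧸ H))) +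
      (capacity (quotientChannel H' W) - Real.log (Nat.card (G ⧸ H'))) -
      Real.log (Nat.card (H ⊓ H' : AddSubgroup G)) ≤
    capacity W - Real.log (Fintype.card G) := by
  have hq : (0 : ℝ) < Fintype.card G := by exact_mod_cast Fintype.card_pos
  rw [capacity_quotientChannel hW, capacity_quotientChannel hW, capacity_eq hW]
  have hlog : Real.log (Nat.card (H ⊓ H' : AddSubgroup G)) = (1 / (Fintype.card G : ℝ)) *
      ∑ y, (∑ x, W x y) * Real.log (Nat.card (H ⊓ H' : AddSubgroup G)) := by
    rw [← Finset.sum_mul, hW.sum_sum]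
    field_simp
  rw [hlog]
  simp only [add_sub_cancel_left, ← mul_add, ← mul_sub, ← Finset.sum_add_distrib,
    ← Finset.sum_sub_distrib]
  refine mul_le_mul_of_nonneg_left (Finset.sum_le_sum fun y _ => ?_) (by positivity)
  have := sum_mul_log_fibers_le (fun x => W x y) (fun x => hW.1 x y)
    (fun x : G => (x : G ⧸ H)) (fun x : G => (x : G ⧸ H')) _ (card_inter_cosets_le H H')
  linarith

lemma two_mul_card_inf_le (H H' : AddSubgroup G) (h : ¬ H ≤ H') :
    2 * Nat.card (H ⊓ H' : AddSubgroup G) ≤ Nat.card H := by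
  obtain ⟨k, hk⟩ := AddSubgroup.card_dvd_of_le (inf_le_left : H ⊓ H' ≤ H)
  have hpos : 0 < Nat.card H := Nat.card_pos
  have hk0 : k ≠ 0 := by
    rintro rfl
    omega
  have hk1 : k ≠ 1 := by
    rintro rfl
    refine h (inf_eq_left.1 (AddSubgroup.eq_of_le_of_card_ge inf_le_left ?_))
    omega
  rw [hk, mul_comm]
  exact Nat.mul_le_mul_left _ (by omega)

lemma DeterminedBy.mono {H : AddSubgroup G} {δ ε : ℝ} (h : DeterminedBy W H δ) (hδ : δ ≤ ε) :
    DeterminedBy W H ε :=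
  ⟨h.1.trans_le hδ, h.2.trans_le hδ⟩

lemma DeterminedBy.map (hsym : IsAutSymmetric W) (f : G ≃+ G) {H : AddSubgroup G} {δ : ℝ}
    (h : DeterminedBy W H δ) : DeterminedBy W (H.map f.toAddMonoidHom) δ := by
  obtain ⟨π, hπ⟩ := hsym f
  let e : G ⧸ H ≃+ G ⧸ H.map f.toAddMonoidHom := QuotientAddGroup.congr H _ f rfl
  have hcard : Nat.card (G ⧸ H.map f.toAddMonoidHom) = Nat.card (G ⧸ H) :=
    (Nat.card_congr e.toEquiv).symm
  have hH : Nat.card (H.map f.toAddMonoidHom) = Nat.card H :=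
    (Nat.card_congr (f.addSubgroupMap H).toEquiv).symm
  have hcap : capacity (quotientChannel (H.map f.toAddMonoidHom) W) =
      capacity (quotientChannel H W) := by
    refine capacity_congr e.toEquiv π fun A y => ?_
    simp only [quotientChannel, hH]
    rw [← f.toEquiv.sum_comp]
    congr 1
    refine Finset.sum_congr rfl fun x _ => ?_
    have : ((f x : G) : G ⧸ H.map f.toAddMonoidHom) = e A ↔ (x : G ⧸ H) = A := by
      rw [← e.injective.eq_iff]
      rfl
    change (if ((f x : G) : G ⧸ H.map f.toAddMonoidHom) = e A then W (f x) (π y) else 0) = _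
    simp only [this, hπ]
  unfold DeterminedBy
  rw [hcard, hcap]
  exact h

lemma DeterminedBy.le_of_determinedBy (hW : IsChannel W) {H H' : AddSubgroup G} {δ : ℝ}
    (hδ : δ ≤ Real.log 2 / 3) (h : DeterminedBy W H δ) (h' : DeterminedBy W H' δ) : H ≤ H' := by
  by_contra hle
  have hK : (0 : ℝ) < Nat.card (H ⊓ H' : AddSubgroup G) := by exact_mod_cast Nat.card_pos
  have hcard : Real.log (2 * Nat.card (H ⊓ H' : AddSubgroup G)) ≤ Real.log (Nat.card H) :=
    Real.log_le_log (by positivity) (by exact_mod_cast two_mul_card_inf_le H H' hle)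
  rw [Real.log_mul (by norm_num) hK.ne'] at hcard
  have h1 := (abs_lt.1 h.1).2
  have h2 := (abs_lt.1 h.2).1
  have h3 := (abs_lt.1 h'.2).1
  have h4 := capacity_ge_of_quotients hW H H'
  have h5 := log_card_quotient H
  linarith

lemma isChannel_minusChannel (hW : IsChannel W) : IsChannel (minusChannel W) := by
  have hq : (Fintype.card G : ℝ) ≠ 0 := by exact_mod_cast Fintype.card_ne_zero
  refine ⟨fun x y => mul_nonneg (by positivity)
    (Finset.sum_nonneg fun u _ => mul_nonneg (hW.1 _ _) (hW.1 _ _)), fun x => ?_⟩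
  simp only [minusChannel]
  rw [← Finset.mul_sum, Finset.sum_comm]
  simp only [Fintype.sum_prod_type, ← Finset.sum_mul_sum, hW.2]
  simp [hq]

lemma isChannel_plusChannel (hW : IsChannel W) : IsChannel (plusChannel W) := by
  have hq : (Fintype.card G : ℝ) ≠ 0 := by exact_mod_cast Fintype.card_ne_zero
  refine ⟨fun x y => mul_nonneg (mul_nonneg (by positivity) (hW.1 _ _)) (hW.1 _ _), fun x => ?_⟩
  simp only [plusChannel, mul_assoc]
  rw [← Finset.mul_sum, Fintype.sum_prod_type_right]
  simp only [Fintype.sum_prod_type, ← Finset.sum_mul_sum, hW.2]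
  simp [hq]

end Subgroups

lemma isAutSymmetric_minusChannel {G Y : Type*} [AddCommGroup G] [Fintype G] {W : G → Y → ℝ}
    (hW : IsAutSymmetric W) : IsAutSymmetric (minusChannel W) := by
  intro f
  obtain ⟨π, hπ⟩ := hW f
  refine ⟨π.prodCongr π, fun x y => ?_⟩
  simp only [minusChannel]
  rw [← f.toEquiv.sum_comp]
  simp [← map_add, hπ]

lemma isAutSymmetric_plusChannel {G Y : Type*} [AddCommGroup G] [Fintype G] {W : G → Y → ℝ}
    (hW : IsAutSymmetric W) : IsAutSymmetric (plusChannel W) := by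
  intro f
  obtain ⟨π, hπ⟩ := hW f
  refine ⟨(π.prodCongr π).prodCongr f.toEquiv, fun x y => ?_⟩
  simp [plusChannel, ← map_add, hπ]

lemma Channel.polar_isChannel_and_isAutSymmetric {G : Type u} [AddCommGroup G] [Fintype G]
    (s : List Bool) (C : Channel G) (hC : IsChannel C.prob) (hsym : IsAutSymmetric C.prob) :
    IsChannel (C.polar s).prob ∧ IsAutSymmetric (C.polar s).prob := by
  induction s generalizing C with
  | nil => exact ⟨hC, hsym⟩
  | cons b s ih =>
    cases b
    · exact ih C.minus (isChannel_minusChannel hC) (isAutSymmetric_minusChannel hsym)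
    · exact ih C.plus (isChannel_plusChannel hC) (isAutSymmetric_plusChannel hsym)

/-- if the only characteristic subgroups of `G` are `{0}` and `G`, then every
automorphic-symmetric channel (satisfying the background polarization property) strongly
polarizes. -/
theorem stmt_14 {G : Type u} [AddCommGroup G] [Fintype G]
    (htriv : ∀ H : AddSubgroup G,
      (∀ f : G ≃+ G, H.map f.toAddMonoidHom = H) → H = ⊥ ∨ H = ⊤)
    (C : Channel G) (hC : IsChannel C.prob) (hsym : IsAutSymmetric C.prob)
    (hbg : Polarizes C Set.univ) :
    ∀ δ > (0 : ℝ), Filter.Tendsto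
      (fun n : ℕ => ((Finset.univ.filter (fun s : Fin n → Bool =>
          DeterminedBy (C.polar (List.ofFn s)).prob (⊥ : AddSubgroup G) δ ∨
          DeterminedBy (C.polar (List.ofFn s)).prob (⊤ : AddSubgroup G) δ)).card : ℝ) / 2 ^ n)
      Filter.atTop (nhds 1) := by
  intro δ hδ
  have hlog : 0 < Real.log 2 := Real.log_pos (by norm_num)
  have hε : 0 < min δ (Real.log 2 / 3) := lt_min hδ (by positivity)
  refine tendsto_of_tendsto_of_tendsto_of_le_of_le (hbg _ hε) tendsto_const_nhds ?_ ?_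
  · intro n
    refine div_le_div_of_nonneg_right ?_ (by positivity)
    refine Nat.cast_le.2 (Finset.card_le_card fun s hs => ?_)
    simp only [Finset.mem_filter, Finset.mem_univ, true_and, Set.mem_univ] at hs ⊢
    obtain ⟨H, hH⟩ := hs
    obtain ⟨hCs, hsyms⟩ := C.polar_isChannel_and_isAutSymmetric (List.ofFn s) hC hsym
    have hchar : H = ⊥ ∨ H = ⊤ := htriv H fun f =>
      le_antisymm ((hH.map hsyms f).le_of_determinedBy hCs (min_le_right _ _) hH)
        (hH.le_of_determinedBy hCs (min_le_right _ _) (hH.map hsyms f))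
    rcases hchar with rfl | rfl
    exacts [Or.inl (hH.mono (min_le_left _ _)), Or.inr (hH.mono (min_le_left _ _))]
  · intro n
    refine div_le_one_of_le₀ ?_ (by positivity)
    refine (Nat.cast_le.2 (Finset.card_filter_le _ _)).trans ?_
    simp

end
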